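/- The natural inclusion J : C[0,1] → L_{2,1}[0,1] (with respect to Lebesgue measure) is (2,1)-summing but not 2-summing. Consequently, since L_{2,1}[0,1] is separable and hence embeds isometrically into ℓ∞, there exists a bounded linear operator R : C[0,1] → ℓ∞ that is (2,1)-summing but not 2-summing. -/

import Mathlib

set_option maxHeartbeats 1000000
set_option synthInstance.maxHeartbeats 400000

noncomputable section

open scoped BigOperators NNReal ENNReal
open NormedSpace

/-- The scalar field. -/
notation "𝕂" => ℝ
section Summing

variable {E F : Type} [NormedAddCommGroup E] [NormedSpace 𝕂 E]
  [NormedAddCommGroup F] [NormedSpace 𝕂 F]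

/-- The weak ℓ_q norm of a finite family of vectors:
`sup { (Σ_i ‖e*(e_i)‖^q)^(1/q) : e* ∈ E*, ‖e*‖ ≤ 1 }`. -/
def weakNorm (q : ℝ) {n : ℕ} (e : Fin n → E) : ℝ :=
  ⨆ f : {f : StrongDual 𝕂 E // ‖f‖ ≤ 1}, (∑ i, ‖(f : StrongDual 𝕂 E) (e i)‖ ^ q) ^ (1 / q)

/-- `T` satisfies the (p,q)-summing inequality with constant `C`:
`(Σ_i ‖T e_i‖^p)^(1/p) ≤ C · sup { (Σ_i ‖e*(e_i)‖^q)^(1/q) : ‖e*‖ ≤ 1 }`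
for all finite families `e_1, …, e_n`. -/
def SummingWithC (p q C : ℝ) (T : E →L[𝕂] F) : Prop :=
  ∀ (n : ℕ) (e : Fin n → E),
    (∑ i, ‖T (e i)‖ ^ p) ^ (1 / p) ≤ C * weakNorm q e

/-- `T` is (p,q)-summing. -/
def IsPQSumming (p q : ℝ) (T : E →L[𝕂] F) : Prop :=
  ∃ C, 0 ≤ C ∧ SummingWithC p q C T

/-- `T` is p-summing. -/
def IsPSumming (p : ℝ) (T : E →L[𝕂] F) : Prop := IsPQSumming p p T

/-- The p-summing norm `π_p(T)`: the least admissible constant. -/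
def pNorm (p : ℝ) (T : E →L[𝕂] F) : ℝ :=
  sInf {C | 0 ≤ C ∧ SummingWithC p p C T}

end Summing

/-- For `f : C(Ω, 𝕂)` and a vector `y`, the function `f ⊗ y : t ↦ f(t) • y`, under the
identification `C(Ω) ⊗̂_ε H = C(Ω, H)`. -/
def cmSmul {Ω : Type} [TopologicalSpace Ω] {H : Type} [NormedAddCommGroup H]
    [NormedSpace 𝕂 H] (f : C(Ω, 𝕂)) (y : H) : C(Ω, H) :=
  ⟨fun t => f t • y, (map_continuous f).smul continuous_const⟩

attribute [local instance] MeasureTheory.Measure.Subtype.measureSpace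

/-- The distribution function `s ↦ vol {t : |g t| > s}` of a function on `[0,1]`. -/
def distribFn (g : Set.Icc (0 : ℝ) 1 → ℝ) (s : ℝ) : ℝ≥0∞ :=
  MeasureTheory.volume {t : Set.Icc (0 : ℝ) 1 | s < |g t|}

/-- The decreasing rearrangement `g*` of (the absolute value of) a function on `[0,1]`. -/
def decRearrange (g : Set.Icc (0 : ℝ) 1 → ℝ) (t : ℝ) : ℝ :=
  sInf {s : ℝ | 0 ≤ s ∧ distribFn g s ≤ ENNReal.ofReal t}

/-- The Lorentz `L_{2,1}[0,1]` norm: `‖g‖_{L_{2,1}} = ∫₀^∞ t^{-1/2} g*(t) dt`. -/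
def L21Norm (g : Set.Icc (0 : ℝ) 1 → ℝ) : ℝ :=
  ∫ t in Set.Ioi (0 : ℝ), t ^ (-(1 : ℝ) / 2) * decRearrange g t


abbrev UI : Type := Set.Icc (0 : ℝ) 1

open MeasureTheory Set

lemma sq_bound_of_forall {L M I : ℝ} (hL : 0 ≤ L) (hM : 0 ≤ M) (hI : 0 ≤ I)
    (h : ∀ b : ℝ, 0 < b → L ≤ 4 * b * M + I / b) : L ^ 2 ≤ 16 * (M * I) := by
  rcases hL.eq_or_lt with h0 | hL
  · rw [← h0]
    have := mul_nonneg hM hI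
    linarith
  rcases hM.eq_or_lt with h0 | hM
  · exfalso
    have := h ((I + 1) / L) (by positivity)
    rw [← h0] at this
    have e : I / ((I + 1) / L) = L * I / (I + 1) := by field_simp
    rw [e] at this
    have h2 : L * I / (I + 1) < L := by
      rw [div_lt_iff₀ (by positivity)]; nlinarith
    linarith
  · have := h (L / (8 * M)) (by positivity)
    have e : 4 * (L / (8 * M)) * M + I / (L / (8 * M)) = L / 2 + 8 * (M * I) / L := by
      field_simp; ring
    rw [e] at this
    have h3 : L / 2 ≤ 8 * (M * I) / L := by linarith
    rw [le_div_iff₀ hL] at h3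
    nlinarith

/-- The weak 1-norm dominates `Σ |v_i(t)|`. -/
lemma sum_abs_le_weakNorm {n : ℕ} (v : Fin n → C(UI, ℝ)) (t : UI) :
    ∑ i, |v i t| ≤ weakNorm 1 v := by
  let δ : StrongDual ℝ C(UI, ℝ) := ContinuousMap.evalCLM ℝ t
  have hδ : ‖δ‖ ≤ 1 := by
    refine ContinuousLinearMap.opNorm_le_bound _ zero_le_one fun f => ?_
    rw [one_mul]; exact f.norm_coe_le_norm t
  have hb : BddAbove (range fun f : {f : StrongDual ℝ C(UI, ℝ) // ‖f‖ ≤ 1} =>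
      (∑ i, ‖(f : StrongDual ℝ C(UI, ℝ)) (v i)‖ ^ (1 : ℝ)) ^ (1 / (1 : ℝ))) := by
    refine ⟨∑ i, ‖v i‖, ?_⟩
    rintro _ ⟨f, rfl⟩
    simp only [Real.rpow_one, div_one]
    refine Finset.sum_le_sum fun i _ => ?_
    calc ‖(f : StrongDual ℝ C(UI, ℝ)) (v i)‖ ≤ ‖(f : StrongDual ℝ C(UI, ℝ))‖ * ‖v i‖ :=
          ContinuousLinearMap.le_opNorm _ _
      _ ≤ 1 * ‖v i‖ := by gcongr; exact f.2
      _ = _ := one_mul _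
  have := le_ciSup hb ⟨δ, hδ⟩
  simp only [Real.rpow_one, div_one] at this
  simpa [weakNorm, δ] using this

lemma summing_generic (L : C(UI, ℝ) → ℝ) (hL0 : ∀ f, 0 ≤ L f)
    (hL : ∀ f, ∀ b : ℝ, 0 < b → L f ≤ 4 * b * ‖f‖ + (∫ t, |f t|) / b)
    (n : ℕ) (v : Fin n → C(UI, ℝ)) :
    (∑ i, L (v i) ^ (2 : ℝ)) ^ ((1 : ℝ) / 2) ≤ 4 * weakNorm 1 v := by
  set W := weakNorm 1 v with hWdef
  have hW : ∀ t, ∑ i, |v i t| ≤ W := sum_abs_le_weakNorm v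
  have hW0 : 0 ≤ W := (Finset.sum_nonneg fun i _ => abs_nonneg _).trans (hW ⟨0, by simp⟩)
  have hint : ∀ i, Integrable (fun t : UI => |v i t|) := fun i =>
    ((map_continuous (v i)).abs).integrable_of_hasCompactSupport
      (HasCompactSupport.of_compactSpace _)
  have hM : ∀ i, ‖v i‖ ≤ W := fun i => by
    rw [ContinuousMap.norm_le _ hW0]
    intro t
    exact (Finset.single_le_sum (f := fun i => |v i t|) (fun i _ => abs_nonneg _)
      (Finset.mem_univ i)).trans (hW t)
  have hI : ∑ i, ∫ t, |v i t| ≤ W := by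
    rw [← integral_finsetSum _ fun i _ => hint i]
    calc ∫ t, ∑ i, |v i t| ≤ ∫ t : UI, W :=
          integral_mono (integrable_finsetSum _ fun i _ => hint i) (integrable_const _) hW
      _ = W := by simp
  have hI0 : ∀ i, 0 ≤ ∫ t, |v i t| := fun i => integral_nonneg fun t => abs_nonneg _
  have key : ∑ i, L (v i) ^ (2 : ℝ) ≤ (4 * W) ^ 2 := by
    calc ∑ i, L (v i) ^ (2 : ℝ) ≤ ∑ i, 16 * W * ∫ t, |v i t| := by
          refine Finset.sum_le_sum fun i _ => ?_
          rw [Real.rpow_two]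
          have := sq_bound_of_forall (hL0 (v i)) (norm_nonneg _) (hI0 i) (hL (v i))
          nlinarith [mul_le_mul_of_nonneg_right (hM i) (hI0 i)]
      _ = 16 * W * ∑ i, ∫ t, |v i t| := by rw [Finset.mul_sum]
      _ ≤ 16 * W * W := by gcongr
      _ = _ := by ring
  rw [← Real.sqrt_eq_rpow]
  exact Real.sqrt_le_iff.2 ⟨by positivity, key⟩

/-- Upper bound for weak 2-norms. -/
lemma weakNorm_two_le {n : ℕ} (v : Fin n → C(UI, ℝ)) {B : ℝ} (hB : 0 ≤ B)
    (h : ∀ t, ∑ i, v i t ^ 2 ≤ B) : weakNorm 2 v ≤ √B := by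
  have : Nonempty {f : StrongDual ℝ C(UI, ℝ) // ‖f‖ ≤ 1} := ⟨⟨0, (norm_zero (E := StrongDual ℝ C(UI, ℝ))).le.trans zero_le_one⟩⟩
  refine ciSup_le fun f => ?_
  rw [← Real.sqrt_eq_rpow]
  apply Real.sqrt_le_sqrt
  obtain ⟨f, hf⟩ := f
  simp only [Real.rpow_two, Real.norm_eq_abs, sq_abs]
  set A := ∑ i, (f (v i)) ^ 2 with hA
  have hA0 : 0 ≤ A := Finset.sum_nonneg fun i _ => sq_nonneg _
  have h1 : A = f (∑ i, f (v i) • v i) := by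
    simp [hA, sq]
  have h2 : ‖∑ i, f (v i) • v i‖ ≤ √(A * B) := by
    rw [ContinuousMap.norm_le _ (Real.sqrt_nonneg _)]
    intro t
    rw [Real.norm_eq_abs]
    apply Real.abs_le_sqrt
    have := Finset.sum_mul_sq_le_sq_mul_sq Finset.univ (fun i => f (v i)) (fun i => v i t)
    simp only [ContinuousMap.coe_sum, Finset.sum_apply, ContinuousMap.coe_smul, Pi.smul_apply,
      smul_eq_mul]
    exact this.trans (by gcongr; exact h t)
  have h3 : A ≤ √(A * B) := by
    calc A = f (∑ i, f (v i) • v i) := h1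
      _ ≤ ‖f (∑ i, f (v i) • v i)‖ := Real.le_norm_self _
      _ ≤ ‖f‖ * ‖∑ i, f (v i) • v i‖ := f.le_opNorm _
      _ ≤ 1 * √(A * B) := by gcongr
      _ = _ := one_mul _
  have h4 : A ^ 2 ≤ A * B := by
    have := pow_le_pow_left₀ hA0 h3 2
    rwa [Real.sq_sqrt (by positivity)] at this
  rcases hA0.eq_or_lt with h0 | h0
  · rw [← h0]; exact hB
  · rw [sq] at h4; exact le_of_mul_le_mul_left h4 h0

/-- The test functions. -/
def phi (N : ℕ) (x : ℝ) : C(UI, ℝ) where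
  toFun t := (√(1 / ((N : ℝ) + 1) + |(t : ℝ) - x|))⁻¹
  continuous_toFun := by
    refine Continuous.inv₀ (by fun_prop) fun t => ?_
    have : 0 < 1 / ((N : ℝ) + 1) + |(t : ℝ) - x| := by positivity
    exact (Real.sqrt_pos.2 this).ne'

lemma phi_apply (N : ℕ) (x : ℝ) (t : UI) :
    phi N x t = (√(1 / ((N : ℝ) + 1) + |(t : ℝ) - x|))⁻¹ := rfl

lemma phi_sq (N : ℕ) (x : ℝ) (t : UI) :
    phi N x t ^ 2 = (1 / ((N : ℝ) + 1) + |(t : ℝ) - x|)⁻¹ := by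
  rw [phi_apply, inv_pow, Real.sq_sqrt (by positivity)]

lemma harm_le (k : ℕ) {l : ℕ} (h : k ≤ l) :
    ∑ i ∈ Finset.range k, (1 + (i : ℝ))⁻¹ ≤ 1 + Real.log l := by
  calc ∑ i ∈ Finset.range k, (1 + (i : ℝ))⁻¹ ≤ ∑ i ∈ Finset.range l, (1 + (i : ℝ))⁻¹ :=
        Finset.sum_le_sum_of_subset_of_nonneg (by simpa using h) fun i _ _ => by positivity
    _ = ((harmonic l : ℚ) : ℝ) := by
        simp [harmonic, add_comm]
    _ ≤ _ := harmonic_le_one_add_log l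

lemma sum_nat_le (N m : ℕ) (hm : m ≤ N) :
    ∑ i ∈ Finset.range N, (1 + |(m : ℝ) - i|)⁻¹ ≤ 2 * (1 + Real.log (N + 1)) := by
  have hsub : Finset.range N ⊆ Finset.range (m + 1) ∪ Finset.Ico m (m + N) := by
    intro i; simp; omega
  have h1 : ∑ i ∈ Finset.range (m + 1), (1 + |(m : ℝ) - i|)⁻¹ ≤ 1 + Real.log (N + 1) := by
    rw [← Finset.sum_range_reflect]
    have := harm_le (m + 1) (l := N + 1) (by omega)
    push_cast at this
    refine le_trans (le_of_eq ?_) this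
    refine Finset.sum_congr rfl fun i hi => ?_
    simp at hi
    have : ((m + 1 - 1 - i : ℕ) : ℝ) = m - i := by
      rw [Nat.cast_sub (by omega)]; simp
    rw [this]; simp
  have h2 : ∑ i ∈ Finset.Ico m (m + N), (1 + |(m : ℝ) - i|)⁻¹ ≤ 1 + Real.log (N + 1) := by
    rw [Finset.sum_Ico_eq_sum_range]
    have := harm_le (m + N - m) (l := N + 1) (by omega)
    push_cast at this
    refine le_trans (le_of_eq ?_) this
    refine Finset.sum_congr rfl fun i hi => ?_
    simp
  calc _ ≤ ∑ i ∈ Finset.range (m + 1) ∪ Finset.Ico m (m + N), (1 + |(m : ℝ) - i|)⁻¹ :=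
        Finset.sum_le_sum_of_subset_of_nonneg hsub fun i _ _ => by positivity
    _ ≤ ∑ i ∈ Finset.range (m + 1), (1 + |(m : ℝ) - i|)⁻¹
        + ∑ i ∈ Finset.Ico m (m + N), (1 + |(m : ℝ) - i|)⁻¹ := by
        rw [← Finset.sum_union_inter]
        have : 0 ≤ ∑ i ∈ Finset.range (m + 1) ∩ Finset.Ico m (m + N), (1 + |(m : ℝ) - i|)⁻¹ :=
          Finset.sum_nonneg fun i _ => by positivity
        linarith
    _ ≤ _ := by linarith

lemma sum_phi_sq_le (N : ℕ) (t : UI) :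
    ∑ i : Fin (N + 1), phi N ((i : ℕ) / ((N : ℝ) + 1)) t ^ 2
      ≤ ((N : ℝ) + 1) * (4 * (1 + Real.log (N + 1 + 1))) := by
  obtain ⟨t, ht0, ht1⟩ := t
  rw [Fin.sum_univ_eq_sum_range (fun i : ℕ => phi N ((i : ℕ) / ((N : ℝ) + 1)) ⟨t, ht0, ht1⟩ ^ 2)]
  set y := ((N : ℝ) + 1) * t with hy
  have hy0 : 0 ≤ y := by positivity
  set m := ⌊y⌋₊
  have hm : m ≤ N + 1 := by
    apply Nat.floor_le_of_le
    push_cast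
    nlinarith
  have hm1 : (m : ℝ) ≤ y := Nat.floor_le hy0
  have hm2 : y < m + 1 := Nat.lt_floor_add_one y
  have := sum_nat_le (N + 1) m hm
  push_cast at this
  calc _ ≤ ∑ i ∈ Finset.range (N + 1), ((N : ℝ) + 1) * (2 * (1 + |(m : ℝ) - i|)⁻¹) := by
        refine Finset.sum_le_sum fun i _ => ?_
        rw [phi_sq]
        have e : 1 / ((N : ℝ) + 1) + |t - i / ((N : ℝ) + 1)| = (1 + |y - i|) / ((N : ℝ) + 1) := by
          have : t - i / ((N : ℝ) + 1) = (y - i) / ((N : ℝ) + 1) := by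
            rw [hy]; field_simp
          rw [this, abs_div, abs_of_pos (by positivity : (0 : ℝ) < N + 1)]; ring
        simp only []
        rw [e, inv_div, div_eq_mul_inv]
        gcongr
        rw [← div_eq_mul_inv, inv_eq_one_div, div_le_div_iff₀ (by positivity) (by positivity)]
        have : |(m : ℝ) - i| ≤ |y - i| + 1 := by
          have := abs_sub_abs_le_abs_sub ((m : ℝ) - i) (y - i)
          have h3 : |(m : ℝ) - i - (y - i)| ≤ 1 := by rw [abs_le]; constructor <;> linarith
          linarith
        linarith [abs_nonneg (y - i)]
    _ = ((N : ℝ) + 1) * (2 * ∑ i ∈ Finset.range (N + 1), (1 + |(m : ℝ) - i|)⁻¹) := by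
        rw [Finset.mul_sum, Finset.mul_sum]
    _ ≤ ((N : ℝ) + 1) * (2 * (2 * (1 + Real.log (N + 1 + 1)))) := by gcongr
    _ = _ := by ring

lemma not_summing_generic (L : C(UI, ℝ) → ℝ)
    (hL : ∀ (N i : ℕ), (i : ℝ) ≤ N + 1 →
      Real.log (N + 1 + 1) / 2 ≤ L (phi N ((i : ℝ) / ((N : ℝ) + 1)))) :
    ¬ (∃ C, 0 ≤ C ∧ ∀ (n : ℕ) (v : Fin n → C(UI, ℝ)),
        (∑ i, L (v i) ^ (2 : ℝ)) ^ ((1 : ℝ) / 2) ≤ C * weakNorm 2 v) := by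
  rintro ⟨C, hC, h⟩
  have hlim : Filter.Tendsto (fun N : ℕ => Real.log ((N : ℝ) + 1 + 1)) Filter.atTop Filter.atTop :=
    Real.tendsto_log_atTop.comp (Filter.tendsto_atTop_add_const_right _ _
      (Filter.tendsto_atTop_add_const_right _ _ tendsto_natCast_atTop_atTop))
  obtain ⟨N, hN⟩ := (hlim.eventually_ge_atTop (32 * C ^ 2 + 1)).exists
  set l := Real.log ((N : ℝ) + 1 + 1) with hl
  have hl1 : 1 ≤ l := by nlinarith [sq_nonneg C]
  have h1 := h (N + 1) (fun i => phi N ((i : ℕ) / ((N : ℝ) + 1)))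
  have hB : 0 ≤ ((N : ℝ) + 1) * (4 * (1 + l)) := by positivity
  have h2 := weakNorm_two_le (fun i : Fin (N + 1) => phi N ((i : ℕ) / ((N : ℝ) + 1))) hB
    (sum_phi_sq_le N)
  have h3 : ((N : ℝ) + 1) * (l / 2) ^ 2
      ≤ ∑ i : Fin (N + 1), L (phi N ((i : ℕ) / ((N : ℝ) + 1))) ^ (2 : ℝ) := by
    have : ((N : ℝ) + 1) * (l / 2) ^ 2 = ∑ i : Fin (N + 1), (l / 2) ^ 2 := by simp
    rw [this]
    refine Finset.sum_le_sum fun i _ => ?_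
    rw [Real.rpow_two]
    have : ((i : ℕ) : ℝ) ≤ N + 1 := by exact_mod_cast i.2.le
    have := hL N i this
    gcongr
  rw [← Real.sqrt_eq_rpow] at h1
  have h4 : √(((N : ℝ) + 1) * (l / 2) ^ 2) ≤ C * √(((N : ℝ) + 1) * (4 * (1 + l))) :=
    (Real.sqrt_le_sqrt h3).trans (h1.trans (by gcongr))
  have h5 := pow_le_pow_left₀ (Real.sqrt_nonneg _) h4 2
  rw [mul_pow, Real.sq_sqrt (by positivity), Real.sq_sqrt hB] at h5
  have h6 : (l / 2) ^ 2 ≤ C ^ 2 * (4 * (1 + l)) := by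
    have : (0 : ℝ) < N + 1 := by positivity
    refine le_of_mul_le_mul_left ?_ this
    linarith
  have h7 : l * l ≤ 32 * C ^ 2 * l := by nlinarith [sq_nonneg C]
  have := le_of_mul_le_mul_right h7 (by linarith)
  linarith

lemma lint_pos (a : ℝ) (ha : 0 ≤ a) :
    ∫⁻ t in Ioc 0 a, (ENNReal.ofReal √|t|)⁻¹ = ENNReal.ofReal (2 * √a) := by
  have h1 : ∫⁻ t in Ioc 0 a, (ENNReal.ofReal √|t|)⁻¹
      = ∫⁻ t in Ioc 0 a, ENNReal.ofReal (t ^ (-(1 : ℝ) / 2)) := by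
    refine setLIntegral_congr_fun measurableSet_Ioc fun t ht => ?_
    try simp only []
    rw [abs_of_pos ht.1, ← ENNReal.ofReal_inv_of_pos (Real.sqrt_pos.2 ht.1), Real.sqrt_eq_rpow,
      ← Real.rpow_neg ht.1.le]
    norm_num
  have hi : IntervalIntegrable (fun t : ℝ => t ^ (-(1 : ℝ) / 2)) volume 0 a :=
    intervalIntegral.intervalIntegrable_rpow' (by norm_num)
  rw [intervalIntegrable_iff_integrableOn_Ioc_of_le ha] at hi
  rw [h1, ← ofReal_integral_eq_lintegral_ofReal hi, ← intervalIntegral.integral_of_le ha,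
    integral_rpow (by left; norm_num)]
  · congr 1
    rw [Real.sqrt_eq_rpow]
    norm_num
    ring
  · filter_upwards [ae_restrict_mem measurableSet_Ioc] with t ht
    exact Real.rpow_nonneg ht.1.le _

lemma lint_sym (a : ℝ) (ha : 0 ≤ a) :
    ∫⁻ t in Ioo (-a) a, (ENNReal.ofReal √|t|)⁻¹ ≤ ENNReal.ofReal (4 * √a) := by
  have hneg : ∫⁻ t in Ico (-a) 0, (ENNReal.ofReal √|t|)⁻¹
      = ∫⁻ t in Ioc 0 a, (ENNReal.ofReal √|t|)⁻¹ := by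
    have := (Measure.measurePreserving_neg (volume : Measure ℝ)).setLIntegral_comp_preimage_emb
      (MeasurableEquiv.neg ℝ).measurableEmbedding (fun t => (ENNReal.ofReal √|t|)⁻¹) (Ioc 0 a)
    simpa using this
  have hsub : Ioo (-a) a ⊆ (Ico (-a) 0 ∪ Ioc 0 a) ∪ {0} := by
    rintro t ⟨h1, h2⟩
    rcases lt_trichotomy t 0 with h | h | h
    · left; left; exact ⟨h1.le, h⟩
    · right; exact h
    · left; right; exact ⟨h, h2.le⟩
  calc _ ≤ ∫⁻ t in (Ico (-a) 0 ∪ Ioc 0 a) ∪ {0}, (ENNReal.ofReal √|t|)⁻¹ :=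
        lintegral_mono_set hsub
    _ ≤ ((∫⁻ t in Ico (-a) 0, (ENNReal.ofReal √|t|)⁻¹)
          + (∫⁻ t in Ioc 0 a, (ENNReal.ofReal √|t|)⁻¹))
          + ∫⁻ t in ({0} : Set ℝ), (ENNReal.ofReal √|t|)⁻¹ :=
        (lintegral_union_le _ _ _).trans (add_le_add_left (lintegral_union_le _ _ _) _)
    _ = ENNReal.ofReal (4 * √a) := by
        rw [hneg, lint_pos a ha, setLIntegral_measure_zero _ _ (by simp), add_zero,
          ← ENNReal.ofReal_add (by positivity) (by positivity)]
        congr 1; ring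

lemma kernel_bound {Ω : Type} [MeasurableSpace Ω] (μ : Measure Ω) (ξ : Ω → ℝ)
    (hξ : Measurable ξ) (hμ : μ.map ξ ≤ volume) (k h : Ω → ℝ≥0∞)
    (hk : ∀ ω, k ω ≤ (ENNReal.ofReal √|ξ ω|)⁻¹) (M : ℝ) (hM : ∀ ω, h ω ≤ ENNReal.ofReal M)
    (b : ℝ) (hb : 0 < b) :
    ∫⁻ ω, k ω * h ω ∂μ ≤ ENNReal.ofReal (4 * b * M) + (∫⁻ ω, h ω ∂μ) * ENNReal.ofReal b⁻¹ := by
  set F : ℝ → ℝ≥0∞ := (Ioo (-(b ^ 2)) (b ^ 2)).indicator fun t => (ENNReal.ofReal √|t|)⁻¹ with hF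
  have hFm : Measurable F := by
    refine Measurable.indicator ?_ measurableSet_Ioo
    fun_prop
  have hFi : ∫⁻ ω, F (ξ ω) ∂μ ≤ ENNReal.ofReal (4 * b) := by
    rw [← lintegral_map hFm hξ]
    refine (lintegral_mono' hμ le_rfl).trans ?_
    rw [hF, lintegral_indicator measurableSet_Ioo]
    refine (lint_sym (b ^ 2) (by positivity)).trans ?_
    rw [Real.sqrt_sq hb.le]
  calc ∫⁻ ω, k ω * h ω ∂μ
      ≤ ∫⁻ ω, F (ξ ω) * ENNReal.ofReal M + h ω * ENNReal.ofReal b⁻¹ ∂μ := by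
        refine lintegral_mono fun ω => ?_
        by_cases hω : ξ ω ∈ Ioo (-(b ^ 2)) (b ^ 2)
        · refine le_add_right ?_
          simp only [hF, indicator_of_mem hω]
          gcongr
          · exact hk ω
          · exact hM ω
        · refine le_add_left ?_
          rw [mul_comm]
          gcongr
          refine (hk ω).trans ?_
          rw [ENNReal.ofReal_inv_of_pos hb]
          gcongr
          refine Real.le_sqrt_of_sq_le ?_
          by_contra hlt
          exact hω (abs_lt.1 (not_le.1 hlt))
    _ = (∫⁻ ω, F (ξ ω) ∂μ) * ENNReal.ofReal M + (∫⁻ ω, h ω ∂μ) * ENNReal.ofReal b⁻¹ := by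
        have hm : Measurable fun ω => F (ξ ω) * ENNReal.ofReal M := (hFm.comp hξ).mul_const _
        rw [lintegral_add_left hm, lintegral_mul_const' _ _ (by simp),
          lintegral_mul_const' _ _ (by simp)]
    _ ≤ _ := by
        rw [ENNReal.ofReal_mul (by positivity)]
        gcongr

lemma lintegral_abs_eq (f : C(UI, ℝ)) :
    ∫⁻ t, ENNReal.ofReal |f t| = ENNReal.ofReal (∫ t, |f t|) := by
  rw [ofReal_integral_eq_lintegral_ofReal]
  · exact ((map_continuous f).abs).integrable_of_hasCompactSupport
      (HasCompactSupport.of_compactSpace _)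
  · exact Filter.Eventually.of_forall fun t => abs_nonneg _

lemma vol_UI : (volume : Measure UI) = Measure.comap Subtype.val volume := rfl

lemma map_sub_le (x : ℝ) : (volume : Measure UI).map (fun t : UI => (t : ℝ) - x) ≤ volume := by
  have h1 : (volume : Measure UI).map (Subtype.val) ≤ (volume : Measure ℝ) := by
    rw [vol_UI, map_comap_subtype_coe measurableSet_Icc]
    exact Measure.restrict_le_self
  have h2 : (volume : Measure UI).map (fun t : UI => (t : ℝ) - x)
      = ((volume : Measure UI).map Subtype.val).map (fun t => t - x) := by
    rw [Measure.map_map (by fun_prop) (by fun_prop)]; rfl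
  rw [h2]
  refine (Measure.map_mono h1 (by fun_prop)).trans ?_
  rw [(measurePreserving_sub_right volume x).map_eq]

lemma coord_bound (N : ℕ) (x : ℝ) (f : C(UI, ℝ)) (b : ℝ) (hb : 0 < b) :
    |∫ t, f t * phi N x t| ≤ 4 * b * ‖f‖ + (∫ t, |f t|) / b := by
  have hI0 : 0 ≤ ∫ t, |f t| := integral_nonneg fun t => abs_nonneg _
  rw [← ENNReal.ofReal_le_ofReal_iff (by positivity)]
  have key := kernel_bound (volume : Measure UI) (fun t => (t : ℝ) - x) (by fun_prop)
    (map_sub_le x) (fun t => ENNReal.ofReal (phi N x t)) (fun t => ENNReal.ofReal |f t|)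
    (fun t => by
      rw [phi_apply, ENNReal.ofReal_inv_of_pos (Real.sqrt_pos.2 (by positivity))]
      gcongr
      simp; positivity) ‖f‖ (fun t => by gcongr; exact f.norm_coe_le_norm t) b hb
  have h1 : ENNReal.ofReal |∫ t, f t * phi N x t|
      ≤ ∫⁻ t, ENNReal.ofReal (phi N x t) * ENNReal.ofReal |f t| := by
    have := enorm_integral_le_lintegral_enorm (μ := (volume : Measure UI))
      (fun t => f t * phi N x t)
    rw [Real.enorm_eq_ofReal_abs] at this
    refine this.trans (le_of_eq (lintegral_congr fun t => ?_))
    have : 0 ≤ phi N x t := by rw [phi_apply]; positivity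
    rw [Real.enorm_eq_ofReal_abs, abs_mul, abs_of_nonneg this, mul_comm, ENNReal.ofReal_mul this]
  refine h1.trans (key.trans (le_of_eq ?_))
  rw [lintegral_abs_eq, ← ENNReal.ofReal_mul hI0, ← ENNReal.ofReal_add (by positivity)
    (by positivity), div_eq_mul_inv]

lemma integ_phi (N : ℕ) (x : ℝ) (f : C(UI, ℝ)) :
    Integrable (fun t => f t * phi N x t) :=
  ((map_continuous f).mul (map_continuous (phi N x))).integrable_of_hasCompactSupport
      (HasCompactSupport.of_compactSpace _)

lemma integral_abs_le (f : C(UI, ℝ)) : ∫ t, |f t| ≤ ‖f‖ := by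
  calc ∫ t, |f t| ≤ ∫ t : UI, ‖f‖ :=
        integral_mono (((map_continuous f).abs).integrable_of_hasCompactSupport
          (HasCompactSupport.of_compactSpace _)) (integrable_const _)
          (fun t => f.norm_coe_le_norm t)
    _ = ‖f‖ := by rw [integral_const]; simp

/-- The operator into `ℓ∞`. -/
def Rop : C(UI, ℝ) →L[ℝ] ↥(lp (fun _ : ℕ => ℝ) ∞) :=
  LinearMap.mkContinuous
    { toFun := fun f => ⟨fun k => ∫ t, f t *
          phi k.unpair.1 ((k.unpair.2 : ℝ) / ((k.unpair.1 : ℝ) + 1)) t, by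
        refine memℓp_infty ⟨4 * 1 * ‖f‖ + (∫ t, |f t|) / 1, ?_⟩
        rintro _ ⟨k, rfl⟩
        exact coord_bound _ _ f 1 one_pos⟩
      map_add' := fun f g => by
        ext k
        simp only [ContinuousMap.add_apply, add_mul]
        exact integral_add (integ_phi _ _ f) (integ_phi _ _ g)
      map_smul' := fun c f => by
        ext k
        simp only [ContinuousMap.smul_apply, smul_eq_mul, mul_assoc]
        exact integral_const_mul _ _ } 5 (fun f => by
      refine lp.norm_le_of_forall_le (by positivity) fun k => ?_
      refine (coord_bound _ _ f 1 one_pos).trans ?_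
      linarith [integral_abs_le f])

lemma Rop_apply (f : C(UI, ℝ)) (k : ℕ) : (Rop f : ∀ _ : ℕ, ℝ) k =
    ∫ t, f t * phi k.unpair.1 ((k.unpair.2 : ℝ) / ((k.unpair.1 : ℝ) + 1)) t := rfl

lemma Rop_bound (f : C(UI, ℝ)) (b : ℝ) (hb : 0 < b) :
    ‖Rop f‖ ≤ 4 * b * ‖f‖ + (∫ t, |f t|) / b := by
  have hI0 : 0 ≤ ∫ t, |f t| := integral_nonneg fun t => abs_nonneg _
  exact lp.norm_le_of_forall_le (by positivity) fun k => coord_bound _ _ f b hb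

lemma log_int (c x y d : ℝ) (hc : 0 < c) (hd : 0 < d) (hxy : x ≤ y) :
    ∫ t in x..y, (c + d * (t - x))⁻¹ = d⁻¹ * (Real.log (c + d * (y - x)) - Real.log c) := by
  have hpos : ∀ t ∈ uIcc x y, 0 < c + d * (t - x) := by
    intro t ht
    rw [uIcc_of_le hxy] at ht
    have : 0 ≤ d * (t - x) := mul_nonneg hd.le (by linarith [ht.1])
    linarith
  have := intervalIntegral.integral_eq_sub_of_hasDerivAt (a := x) (b := y)
    (f := fun t => d⁻¹ * Real.log (c + d * (t - x))) (f' := fun t => (c + d * (t - x))⁻¹)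
    (fun t ht => by
      have h1 : HasDerivAt (fun t : ℝ => c + d * (t - x)) (d * 1) t :=
        (((hasDerivAt_id t).sub_const x).const_mul d).const_add c
      have := (h1.log (hpos t ht).ne').const_mul d⁻¹
      have e : d⁻¹ * (d * 1 / (c + d * (t - x))) = (c + d * (t - x))⁻¹ := by
        rw [mul_one, ← mul_div_assoc, inv_mul_cancel₀ hd.ne', one_div]
      rw [← e]
      exact this)
    (ContinuousOn.intervalIntegrable (ContinuousOn.inv₀ (by fun_prop) fun t ht => (hpos t ht).ne'))
  rw [this]; simp; ring

lemma phi_sq_integral (N : ℕ) (x : ℝ) (hx0 : 0 ≤ x) (hx1 : x ≤ 1) :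
    Real.log (N + 1 + 1) / 2 ≤ ∫ t, phi N x t * phi N x t := by
  set c : ℝ := 1 / ((N : ℝ) + 1) with hc
  have hc0 : 0 < c := by positivity
  have e1 : ∫ t, phi N x t * phi N x t = ∫ t in (0 : ℝ)..1, (c + |t - x|)⁻¹ := by
    rw [intervalIntegral.integral_of_le zero_le_one, ← integral_Icc_eq_integral_Ioc,
      ← integral_subtype_comap measurableSet_Icc]
    refine integral_congr_ae (Filter.Eventually.of_forall fun t => ?_)
    try simp only []
    rw [← sq, phi_sq]
  have hcont : Continuous fun t : ℝ => (c + |t - x|)⁻¹ :=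
    Continuous.inv₀ (by fun_prop) fun t => by positivity
  have h2 : ∫ t in x..1, (c + |t - x|)⁻¹ = Real.log (c + (1 - x)) - Real.log c := by
    have := log_int c x 1 1 hc0 one_pos hx1
    simp only [one_mul, inv_one] at this
    rw [← this]
    refine intervalIntegral.integral_congr fun t ht => ?_
    rw [uIcc_of_le hx1] at ht
    try simp only []
    rw [abs_of_nonneg (by linarith [ht.1])]
  have h1 : ∫ t in (0 : ℝ)..x, (c + |t - x|)⁻¹ = Real.log (c + x) - Real.log c := by
    have := log_int c 0 x 1 hc0 one_pos hx0
    simp only [one_mul, inv_one, sub_zero] at this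
    rw [← this]
    have e := intervalIntegral.integral_comp_sub_left (a := 0) (b := x) (fun t => (c + t)⁻¹) x
    simp only [sub_self, sub_zero] at e
    rw [← e]
    refine intervalIntegral.integral_congr fun t ht => ?_
    rw [uIcc_of_le hx0] at ht
    try simp only []
    rw [abs_of_nonpos (by linarith [ht.2]), neg_sub]
  rw [e1, ← intervalIntegral.integral_add_adjacent_intervals (hcont.intervalIntegrable 0 x)
    (hcont.intervalIntegrable x 1), h1, h2]
  have hN : (N : ℝ) + 1 + 1 = (c + 1) / c := by rw [hc]; field_simp; ring
  rw [hN, Real.log_div (by positivity) hc0.ne']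
  have h3 : Real.log ((c + 1) * c) ≤ Real.log ((c + x) * (c + (1 - x))) := by
    apply Real.log_le_log (by positivity)
    nlinarith [mul_nonneg hx0 (sub_nonneg.2 hx1)]
  have h5 : 0 ≤ Real.log (c + 1) - Real.log c := by
    have := Real.log_le_log hc0 (by linarith : c ≤ c + 1)
    linarith
  rw [Real.log_mul (by positivity) (by positivity),
    Real.log_mul (by positivity) (by linarith)] at h3
  linarith

/-- Only used for grid points. -/
lemma Rop_lower (N i : ℕ) (hi : (i : ℝ) ≤ N + 1) :
    Real.log (N + 1 + 1) / 2 ≤ ‖Rop (phi N ((i : ℝ) / ((N : ℝ) + 1)))‖ := by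
  have h1 := lp.norm_apply_le_norm ENNReal.top_ne_zero
    (Rop (phi N ((i : ℝ) / ((N : ℝ) + 1)))) (Nat.pair N i)
  rw [Rop_apply, Nat.unpair_pair] at h1
  refine le_trans ?_ ((Real.le_norm_self _).trans h1)
  exact phi_sq_integral N _ (by positivity) (by rw [div_le_one (by positivity)]; exact hi)

lemma dec_set_nonempty (f : C(UI, ℝ)) (t : ℝ) :
    ‖f‖ ∈ {s : ℝ | 0 ≤ s ∧ distribFn f s ≤ ENNReal.ofReal t} := by
  refine ⟨norm_nonneg _, ?_⟩
  have : {t : UI | ‖f‖ < |f t|} = ∅ := by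
    ext t
    simpa using f.norm_coe_le_norm t
  unfold distribFn
  rw [this]; simp

lemma dec_bdd (f : C(UI, ℝ)) (t : ℝ) :
    BddBelow {s : ℝ | 0 ≤ s ∧ distribFn f s ≤ ENNReal.ofReal t} := ⟨0, fun _ h => h.1⟩

lemma dec_nonneg (f : C(UI, ℝ)) (t : ℝ) : 0 ≤ decRearrange f t :=
  Real.sInf_nonneg fun _ h => h.1

lemma dec_le (f : C(UI, ℝ)) (t : ℝ) : decRearrange f t ≤ ‖f‖ :=
  csInf_le (dec_bdd f t) (dec_set_nonempty f t)

lemma dec_anti (f : C(UI, ℝ)) : Antitone (decRearrange f) := fun a b hab =>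
  csInf_le_csInf (dec_bdd f b) ⟨_, dec_set_nonempty f a⟩ fun _ h =>
    ⟨h.1, h.2.trans (ENNReal.ofReal_le_ofReal hab)⟩

lemma lt_distrib (f : C(UI, ℝ)) {s t : ℝ} (hs : 0 ≤ s) (h : s < decRearrange f t) :
    ENNReal.ofReal t < distribFn f s := by
  by_contra hc
  exact absurd (csInf_le (dec_bdd f t) ⟨hs, not_lt.1 hc⟩) (not_le.2 h)

lemma lintegral_dec_le (f : C(UI, ℝ)) :
    ∫⁻ t in Ioi (0 : ℝ), ENNReal.ofReal (decRearrange f t) ≤ ENNReal.ofReal (∫ t, |f t|) := by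
  rw [← lintegral_abs_eq,
    lintegral_eq_lintegral_meas_lt _ (Filter.Eventually.of_forall fun t => dec_nonneg f t)
      (dec_anti f).measurable.aemeasurable,
    lintegral_eq_lintegral_meas_lt _ (Filter.Eventually.of_forall fun t => abs_nonneg _)
      (map_continuous f).abs.measurable.aemeasurable]
  refine setLIntegral_mono' measurableSet_Ioi fun s hs => ?_
  have hs : 0 < s := hs
  have hfin : distribFn f s ≠ ∞ := measure_ne_top _ _
  have hsub : {t : ℝ | s < decRearrange f t} ∩ Ioi 0 ⊆ Ioo 0 (distribFn f s).toReal := by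
    rintro t ⟨h1, h2⟩
    exact ⟨h2, (ENNReal.ofReal_lt_iff_lt_toReal (le_of_lt h2) hfin).1 (lt_distrib f hs.le h1)⟩
  rw [Measure.restrict_apply (measurableSet_lt measurable_const (dec_anti f).measurable)]
  refine (measure_mono hsub).trans ?_
  rw [Real.volume_Ioo, sub_zero, ENNReal.ofReal_toReal hfin]
  exact le_rfl

lemma rpow_half (t : ℝ) (ht : 0 ≤ t) : t ^ (-(1 : ℝ) / 2) = (√t)⁻¹ := by
  rw [Real.sqrt_eq_rpow, ← Real.rpow_neg ht]; norm_num

lemma lintegral_L21_le (f : C(UI, ℝ)) (b : ℝ) (hb : 0 < b) :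
    ∫⁻ t in Ioi (0 : ℝ), ENNReal.ofReal (t ^ (-(1 : ℝ) / 2) * decRearrange f t)
      ≤ ENNReal.ofReal (4 * b * ‖f‖ + (∫ t, |f t|) / b) := by
  have hI0 : 0 ≤ ∫ t, |f t| := integral_nonneg fun t => abs_nonneg _
  have key := kernel_bound ((volume : Measure ℝ).restrict (Ioi 0)) id measurable_id
    (by rw [Measure.map_id]; exact Measure.restrict_le_self)
    (fun t => (ENNReal.ofReal √|t|)⁻¹) (fun t => ENNReal.ofReal (decRearrange f t))
    (fun t => le_rfl) ‖f‖ (fun t => ENNReal.ofReal_le_ofReal (dec_le f t)) b hb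
  calc _ = ∫⁻ t in Ioi (0 : ℝ), (ENNReal.ofReal √|t|)⁻¹ * ENNReal.ofReal (decRearrange f t) := by
        refine setLIntegral_congr_fun measurableSet_Ioi fun t ht => ?_
        have ht : 0 < t := ht
        try simp only []
        rw [ENNReal.ofReal_mul (Real.rpow_nonneg ht.le _), rpow_half t ht.le, abs_of_pos ht,
          ENNReal.ofReal_inv_of_pos (Real.sqrt_pos.2 ht)]
    _ ≤ _ := key
    _ ≤ ENNReal.ofReal (4 * b * ‖f‖) + ENNReal.ofReal (∫ t, |f t|) * ENNReal.ofReal b⁻¹ := by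
        gcongr; exact lintegral_dec_le f
    _ = _ := by
        rw [← ENNReal.ofReal_mul hI0, ← ENNReal.ofReal_add (by positivity)
          (by positivity), div_eq_mul_inv]

lemma L21_meas (f : C(UI, ℝ)) :
    Measurable fun t : ℝ => t ^ (-(1 : ℝ) / 2) * decRearrange f t :=
  (by fun_prop : Measurable fun t : ℝ => t ^ (-(1 : ℝ) / 2)).mul (dec_anti f).measurable

lemma L21_nn (f : C(UI, ℝ)) : 0 ≤ᵐ[(volume : Measure ℝ).restrict (Ioi 0)]
    fun t : ℝ => t ^ (-(1 : ℝ) / 2) * decRearrange f t := by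
  filter_upwards [ae_restrict_mem measurableSet_Ioi] with t ht
  exact mul_nonneg (Real.rpow_nonneg (le_of_lt ht) _) (dec_nonneg f t)

lemma L21_integrable (f : C(UI, ℝ)) :
    IntegrableOn (fun t : ℝ => t ^ (-(1 : ℝ) / 2) * decRearrange f t) (Ioi 0) := by
  refine ⟨(L21_meas f).aestronglyMeasurable, ?_⟩
  rw [hasFiniteIntegral_iff_ofReal (L21_nn f)]
  exact (lintegral_L21_le f 1 one_pos).trans_lt ENNReal.ofReal_lt_top

lemma L21_nonneg (f : C(UI, ℝ)) : 0 ≤ L21Norm f := integral_nonneg_of_ae (L21_nn f)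

lemma L21_bound (f : C(UI, ℝ)) (b : ℝ) (hb : 0 < b) :
    L21Norm f ≤ 4 * b * ‖f‖ + (∫ t, |f t|) / b := by
  have hI0 : 0 ≤ ∫ t, |f t| := integral_nonneg fun t => abs_nonneg _
  rw [← ENNReal.ofReal_le_ofReal_iff (by positivity)]
  unfold L21Norm
  rw [ofReal_integral_eq_lintegral_ofReal (L21_integrable f) (L21_nn f)]
  exact lintegral_L21_le f b hb

lemma vol_near (x r : ℝ) (hx0 : 0 ≤ x) (hx1 : x ≤ 1) (hr0 : 0 ≤ r) (hr : r ≤ 1) :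
    ENNReal.ofReal r ≤ (volume : Measure UI) {t : UI | |(t : ℝ) - x| ≤ r} := by
  have e : (volume : Measure UI) {t : UI | |(t : ℝ) - x| ≤ r}
      = volume (Icc (0 : ℝ) 1 ∩ Icc (x - r) (x + r)) := by
    rw [vol_UI, comap_subtype_coe_apply measurableSet_Icc]
    congr 1
    ext t
    simp only [mem_image, mem_ofPred_eq, mem_inter_iff, abs_le]
    constructor
    · rintro ⟨y, hy, rfl⟩
      exact ⟨y.2, by constructor <;> linarith [hy.1, hy.2]⟩
    · rintro ⟨h1, h2⟩
      exact ⟨⟨t, h1⟩, ⟨by linarith [h2.1], by linarith [h2.2]⟩, rfl⟩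
  rw [e, Icc_inter_Icc, Real.volume_Icc]
  apply ENNReal.ofReal_le_ofReal
  rw [le_sub_iff_add_le]
  refine le_min ?_ ?_
  · rw [← le_sub_iff_add_le']
    refine max_le ?_ ?_ <;> linarith
  · rw [← le_sub_iff_add_le']
    refine max_le ?_ ?_ <;> linarith

lemma dec_phi_lower (N : ℕ) (x : ℝ) (hx0 : 0 ≤ x) (hx1 : x ≤ 1) (t : ℝ) (ht0 : 0 < t)
    (ht : t ≤ 1 / 2) : (√(1 / ((N : ℝ) + 1) + 2 * t))⁻¹ ≤ decRearrange (phi N x) t := by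
  refine le_csInf ⟨_, dec_set_nonempty _ t⟩ ?_
  rintro s ⟨hs0, hs⟩
  by_contra hlt
  rw [not_le] at hlt
  have h1 : ENNReal.ofReal (2 * t) ≤ distribFn (phi N x) s := by
    refine (vol_near x (2 * t) hx0 hx1 (by linarith) (by linarith)).trans ?_
    refine measure_mono fun y hy => ?_
    have hy : |(y : ℝ) - x| ≤ 2 * t := hy
    change s < |phi N x y|
    refine hlt.trans_le (le_trans ?_ (le_abs_self _))
    rw [phi_apply]
    have : 0 < 1 / ((N : ℝ) + 1) + |(y : ℝ) - x| := by positivity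
    have := Real.sqrt_pos.2 this
    gcongr
  have h2 := h1.trans hs
  rw [ENNReal.ofReal_le_ofReal_iff ht0.le] at h2
  linarith

lemma L21_lower (N : ℕ) (x : ℝ) (hx0 : 0 ≤ x) (hx1 : x ≤ 1) :
    Real.log (N + 1 + 1) / 2 ≤ L21Norm (phi N x) := by
  set c : ℝ := 1 / ((N : ℝ) + 1) with hc
  have hc0 : 0 < c := by positivity
  have h1 := log_int c 0 (1 / 2) 2 hc0 two_pos (by norm_num)
  have hN : (N : ℝ) + 1 + 1 = (c + 1) / c := by rw [hc]; field_simp; ring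
  have h2 : Real.log (N + 1 + 1) / 2 = ∫ t in Ioc (0 : ℝ) (1 / 2), (c + 2 * (t - 0))⁻¹ := by
    rw [← intervalIntegral.integral_of_le (by norm_num), h1, hN,
      Real.log_div (by positivity) hc0.ne']
    norm_num
    ring
  rw [h2]
  have hsub : Ioc (0 : ℝ) (1 / 2) ⊆ Ioi 0 := fun t ht => ht.1
  calc _ ≤ ∫ t in Ioc (0 : ℝ) (1 / 2), t ^ (-(1 : ℝ) / 2) * decRearrange (phi N x) t := by
        refine setIntegral_mono_on ?_ ((L21_integrable _).mono_set hsub) measurableSet_Ioc ?_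
        · rw [← intervalIntegrable_iff_integrableOn_Ioc_of_le (by norm_num)]
          refine ContinuousOn.intervalIntegrable (ContinuousOn.inv₀ (by fun_prop) fun t ht => ?_)
          rw [uIcc_of_le (by norm_num)] at ht
          have := ht.1
          have : 0 < c + 2 * (t - 0) := by linarith
          exact this.ne'
        · intro t ht
          have ht0 : 0 < t := ht.1
          have hd := dec_phi_lower N x hx0 hx1 t ht.1 ht.2
          rw [rpow_half t ht0.le, sub_zero]
          have hp : 0 < c + 2 * t := by positivity
          have e : (c + 2 * t)⁻¹ = (√(c + 2 * t))⁻¹ * (√(c + 2 * t))⁻¹ := by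
            rw [← mul_inv, Real.mul_self_sqrt hp.le]
          rw [e]
          have hst := Real.sqrt_pos.2 ht0
          refine mul_le_mul ?_ hd (by positivity) (by positivity)
          gcongr
          linarith
    _ ≤ L21Norm (phi N x) :=
        setIntegral_mono_set (L21_integrable _) (L21_nn _) hsub.eventuallyLE


/-- the natural inclusion `J : C[0,1] → L_{2,1}[0,1]` is (2,1)-summing
(`(Σ_i ‖e_i‖²_{L_{2,1}})^(1/2) ≤ C sup_{‖e*‖ ≤ 1} Σ_i |e*(e_i)|`) but not 2-summing.
Consequently (since `L_{2,1}[0,1]` is separable, hence embeds isometrically into `ℓ∞`),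
there exists a bounded linear operator `R : C[0,1] → ℓ∞` that is (2,1)-summing but not
2-summing. -/
theorem statement18 :
    ((∃ C, 0 ≤ C ∧ ∀ (n : ℕ) (v : Fin n → C(Set.Icc (0 : ℝ) 1, ℝ)),
        (∑ i, L21Norm ⇑(v i) ^ (2 : ℝ)) ^ ((1 : ℝ) / 2) ≤ C * weakNorm 1 v) ∧
      ¬ (∃ C, 0 ≤ C ∧ ∀ (n : ℕ) (v : Fin n → C(Set.Icc (0 : ℝ) 1, ℝ)),
        (∑ i, L21Norm ⇑(v i) ^ (2 : ℝ)) ^ ((1 : ℝ) / 2) ≤ C * weakNorm 2 v)) ∧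
    ∃ R : C(Set.Icc (0 : ℝ) 1, ℝ) →L[ℝ] ↥(lp (fun _ : ℕ => ℝ) ∞),
      IsPQSumming 2 1 R ∧ ¬ IsPSumming 2 R := by
  refine ⟨⟨⟨4, by norm_num, fun n v => ?_⟩, ?_⟩, Rop, ⟨4, by norm_num, fun n v => ?_⟩, ?_⟩
  · exact summing_generic (fun f => L21Norm f) L21_nonneg L21_bound n v
  · refine not_summing_generic (fun f => L21Norm f) fun N i hi => L21_lower N _ (by positivity) ?_
    rw [div_le_one (by positivity)]; exact hi
  · exact summing_generic (fun f => ‖Rop f‖) (fun f => norm_nonneg _) Rop_bound n v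
  · exact not_summing_generic (fun f => ‖Rop f‖) Rop_lower
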